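/- arXiv:2601.23173 — 4 statements merged into one kernel-verified Lean document; each statement's English description precedes it below -/
import Mathlib

section
/- For 𝔰 = 3 and every real p with 0 < p < 1, the relative second moment of the alive-particle-filter estimator satisfies E_rel(3, p) = 2/(1 − p) + 2·p·log p/(1 − p)², and moreover 1 + (1 − p)/3 ≤ E_rel(3, p) ≤ 2 − p. -/
/-- The probability mass function of `X = M - 1`, where `M` is the number of i.i.d.
Bernoulli(`p`) trials needed to obtain `𝔰` successes (a shifted negative binomial):
`f_{𝔰,p}(x) = (x! / ((𝔰−1)!·(x+1−𝔰)!))·p^𝔰·(1−p)^{x+1−𝔰}` for integers `x ≥ 𝔰 − 1`. -/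
noncomputable def nbPMF (𝔰 : ℕ) (p : ℝ) (x : ℕ) : ℝ :=
  (Nat.factorial x : ℝ) /
      ((Nat.factorial (𝔰 - 1) : ℝ) * (Nat.factorial (x + 1 - 𝔰) : ℝ)) *
    p ^ 𝔰 * (1 - p) ^ (x + 1 - 𝔰)

/-- The relative second moment `E_rel(𝔰, p) = E[P²]/p²` of the alive-particle-filter
estimator `P = (𝔰−1)/(M−1)`, i.e. `((𝔰−1)²/p²)·∑_{x ≥ 𝔰−1} f_{𝔰,p}(x)/x²`. -/
noncomputable def Erel (𝔰 : ℕ) (p : ℝ) : ℝ :=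
  ((𝔰 : ℝ) - 1) ^ 2 / p ^ 2 *
    ∑' x : ℕ, if 𝔰 - 1 ≤ x then nbPMF 𝔰 p x / (x : ℝ) ^ 2 else 0

/-- The logarithmic series with its first term removed, divided by `(1 - p) ^ 2`. -/
theorem hasSum_one_sub_pow_div_add_two {p : ℝ} (hp0 : 0 < p) (hp1 : p < 1) :
    HasSum (fun n : ℕ => (1 - p) ^ n / ((n : ℝ) + 2))
      ((-Real.log p - (1 - p)) / (1 - p) ^ 2) := by
  have hq : 1 - p ≠ 0 := by linarith
  have h := Real.hasSum_pow_div_log_of_abs_lt_one (x := 1 - p)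
    (abs_lt.2 ⟨by linarith, by linarith⟩)
  rw [sub_sub_cancel] at h
  have h1 := ((hasSum_nat_add_iff' 1).2 h).div_const ((1 - p) ^ 2)
  convert! h1 using 2 with n
  · have hn : (n : ℝ) + 2 ≠ 0 := by positivity
    have hn' : (n : ℝ) + 1 + 1 ≠ 0 := by positivity
    push_cast
    field_simp
    ring
  · simp

/-- For `𝔰 = 3`, the summand defining `Erel` simplifies to
`(p ^ 3 / 2) * (1 - 1 / (n + 2)) * (1 - p) ^ n` at `x = n + 2`. -/
theorem nbPMF_three_div_sq (p : ℝ) (n : ℕ) :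
    nbPMF 3 p (n + 2) / ((n + 2 : ℕ) : ℝ) ^ 2 =
      p ^ 3 / 2 * ((1 - p) ^ n - (1 - p) ^ n / ((n : ℝ) + 2)) := by
  have hn : (n : ℝ) + 2 ≠ 0 := by positivity
  have hf : (n.factorial : ℝ) ≠ 0 := by positivity
  have hsub : n + 2 + 1 - 3 = n := by omega
  simp only [nbPMF, hsub, Nat.factorial_succ]
  push_cast
  norm_num
  field_simp
  ring

theorem Erel_three_eq_tsum {p : ℝ} (hp0 : 0 < p) (hp1 : p < 1) :
    Erel 3 p = 2 - 2 * p * ∑' n : ℕ, (1 - p) ^ n / ((n : ℝ) + 2) := by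
  have hT := (hasSum_one_sub_pow_div_add_two hp0 hp1).summable.hasSum
  have hG : HasSum (fun n : ℕ => (1 - p) ^ n) p⁻¹ := by
    simpa using hasSum_geometric_of_lt_one (r := 1 - p) (by linarith) (by linarith)
  have h := (hG.sub hT).mul_left (p ^ 3 / 2)
  have h2 : HasSum (fun x : ℕ => if 3 - 1 ≤ x then nbPMF 3 p x / (x : ℝ) ^ 2 else 0)
      (p ^ 3 / 2 * (p⁻¹ - ∑' n : ℕ, (1 - p) ^ n / ((n : ℝ) + 2))) := by
    rw [← hasSum_nat_add_iff' 2]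
    convert! h using 1
    · funext n
      rw [if_pos (by omega), nbPMF_three_div_sq]
    · simp [Finset.sum_range_succ]
  rw [Erel, h2.tsum_eq]
  field_simp
  norm_num

theorem half_le_tsum_one_sub_pow_div_add_two {p : ℝ} (hp0 : 0 < p) (hp1 : p < 1) :
    1 / 2 ≤ ∑' n : ℕ, (1 - p) ^ n / ((n : ℝ) + 2) := by
  have hq : 0 ≤ 1 - p := by linarith
  simpa using (hasSum_one_sub_pow_div_add_two hp0 hp1).summable.le_tsum 0
    (fun n _ => by positivity)

theorem tsum_one_sub_pow_div_add_two_le {p : ℝ} (hp0 : 0 < p) (hp1 : p < 1) :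
    ∑' n : ℕ, (1 - p) ^ n / ((n : ℝ) + 2) ≤ 1 / 2 + (1 - p) / (3 * p) := by
  have hq : 0 ≤ 1 - p := by linarith
  have hs := (hasSum_one_sub_pow_div_add_two hp0 hp1).summable
  have hG : HasSum (fun n : ℕ => (1 - p) / 3 * (1 - p) ^ n) ((1 - p) / 3 * p⁻¹) := by
    simpa using (hasSum_geometric_of_lt_one (r := 1 - p) hq (by linarith)).mul_left
      ((1 - p) / 3)
  have hle : ∑' n : ℕ, (1 - p) ^ (n + 1) / (((n + 1 : ℕ) : ℝ) + 2) ≤ (1 - p) / 3 * p⁻¹ := by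
    refine hasSum_le (fun n => ?_) ((summable_nat_add_iff 1).2 hs).hasSum hG
    calc (1 - p) ^ (n + 1) / (((n + 1 : ℕ) : ℝ) + 2) ≤ (1 - p) ^ (n + 1) / 3 := by
          gcongr
          push_cast
          linarith [n.cast_nonneg (α := ℝ)]
      _ = (1 - p) / 3 * (1 - p) ^ n := by ring
  rw [hs.tsum_eq_zero_add]
  have he : (1 - p) / 3 * p⁻¹ = (1 - p) / (3 * p) := by field_simp
  norm_num at hle he ⊢
  linarith

/-- **Proposition 2, case `𝔰 = 3`**: for every `0 < p < 1`,
`E_rel(3, p) = 2/(1 − p) + 2·p·log p/(1 − p)²`, and moreover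
`1 + (1 − p)/3 ≤ E_rel(3, p) ≤ 2 − p`. -/
theorem Erel_three (p : ℝ) (hp0 : 0 < p) (hp1 : p < 1) :
    Erel 3 p = 2 / (1 - p) + 2 * p * Real.log p / (1 - p) ^ 2 ∧
      1 + (1 - p) / 3 ≤ Erel 3 p ∧ Erel 3 p ≤ 2 - p := by
  rw [Erel_three_eq_tsum hp0 hp1]
  refine ⟨?_, ?_, ?_⟩
  · have hq : 1 - p ≠ 0 := by linarith
    rw [(hasSum_one_sub_pow_div_add_two hp0 hp1).tsum_eq]
    field_simp
    ring
  · have h := mul_le_mul_of_nonneg_left (tsum_one_sub_pow_div_add_two_le hp0 hp1) hp0.le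
    have he : p * (1 / 2 + (1 - p) / (3 * p)) = p / 2 + (1 - p) / 3 := by field_simp
    linarith
  · have h := mul_le_mul_of_nonneg_left (half_le_tsum_one_sub_pow_div_add_two hp0 hp1) hp0.le
    linarith
end

section
/- For every integer 𝔰 ≥ 4 and every real p with 0 < p < 1, the relative second moment of the alive-particle-filter estimator satisfies the two-sided bound 1 + (1 − (1 + 2/(𝔰−3))·p)/(𝔰−2) < E_rel(𝔰, p) < 1 + (1 − p)/(𝔰−2). -/
theorem choose_add_one_div (a k : ℕ) :
    ((k + (a + 1)).choose (a + 1) : ℝ) / ((k : ℝ) + a + 1) = ((k + a).choose a : ℝ) / (a + 1) := by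
  rw [div_eq_div_iff (by positivity) (by positivity)]
  have h := Nat.add_one_mul_choose_eq (k + a) a
  have h' : ((k : ℝ) + a + 1) * ((k + a).choose a : ℝ)
      = ((k + (a + 1)).choose (a + 1) : ℝ) * (a + 1) := by exact_mod_cast h
  linarith

theorem hasSum_choose_mul_pow (a : ℕ) {p : ℝ} (hp0 : 0 < p) (hp1 : p < 1) :
    HasSum (fun k : ℕ => ((k + a).choose a : ℝ) * (1 - p) ^ k) (1 / p ^ (a + 1)) := by
  have hq : ‖1 - p‖ < 1 := by
    rw [Real.norm_eq_abs, abs_lt]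
    constructor <;> linarith
  simpa using hasSum_choose_mul_geometric_of_norm_lt_one a hq

theorem nbPMF_add (n k : ℕ) (p : ℝ) :
    nbPMF (n + 4) p (k + (n + 3)) =
      p ^ (n + 4) * (((k + (n + 3)).choose (n + 3) : ℝ) * (1 - p) ^ k) := by
  have h1 : k + (n + 3) + 1 - (n + 4) = k := by omega
  have h2 : n + 4 - 1 = n + 3 := by omega
  rw [nbPMF, h1, h2, Nat.cast_choose ℝ (Nat.le_add_left (n + 3) k), Nat.add_sub_cancel]
  ring

theorem hasSum_nbPMF_div (n : ℕ) {p : ℝ} (hp0 : 0 < p) (hp1 : p < 1) :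
    HasSum (fun k : ℕ => nbPMF (n + 4) p (k + (n + 3)) / ((k : ℝ) + n + 3))
      (p / (n + 3)) := by
  convert (hasSum_choose_mul_pow (n + 2) hp0 hp1).mul_left (p ^ (n + 4) / (n + 3)) using 1
  · rfl
  · funext k
    have h1 := choose_add_one_div (n + 2) k
    push_cast at h1
    have e : (k : ℝ) + (n + 2) + 1 = k + n + 3 := by ring
    have e' : (n : ℝ) + 2 + 1 = n + 3 := by ring
    rw [e, e'] at h1
    rw [nbPMF_add, mul_comm ((Nat.choose _ _ : ℕ) : ℝ), ← mul_assoc, mul_div_assoc, h1]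
    ring
  · field_simp
    ring

theorem hasSum_nbPMF_div_two (n : ℕ) {p : ℝ} (hp0 : 0 < p) (hp1 : p < 1) :
    HasSum (fun k : ℕ => nbPMF (n + 4) p (k + (n + 3)) / (((k : ℝ) + n + 3) * (k + n + 2)))
      (p ^ 2 / ((n + 3) * (n + 2))) := by
  convert (hasSum_choose_mul_pow (n + 1) hp0 hp1).mul_left
    (p ^ (n + 4) / (n + 3) / (n + 2)) using 1
  · rfl
  · funext k
    have h1 := choose_add_one_div (n + 2) k
    have h2 := choose_add_one_div (n + 1) k
    push_cast at h1 h2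
    have e : (k : ℝ) + (n + 2) + 1 = k + n + 3 := by ring
    have e' : (n : ℝ) + 2 + 1 = n + 3 := by ring
    have d : (k : ℝ) + (n + 1) + 1 = k + n + 2 := by ring
    have d' : (n : ℝ) + 1 + 1 = n + 2 := by ring
    rw [e, e'] at h1
    rw [d, d'] at h2
    rw [nbPMF_add, mul_comm ((Nat.choose _ _ : ℕ) : ℝ), ← mul_assoc, mul_div_assoc, ← div_div,
      h1, div_right_comm, h2]
    ring
  · field_simp
    ring

theorem hasSum_nbPMF_div_three (n : ℕ) {p : ℝ} (hp0 : 0 < p) (hp1 : p < 1) :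
    HasSum (fun k : ℕ => nbPMF (n + 4) p (k + (n + 3)) /
        (((k : ℝ) + n + 3) * (k + n + 2) * (k + n + 1)))
      (p ^ 3 / ((n + 3) * (n + 2) * (n + 1))) := by
  convert (hasSum_choose_mul_pow n hp0 hp1).mul_left
    (p ^ (n + 4) / (n + 3) / (n + 2) / (n + 1)) using 1
  · rfl
  · funext k
    have h1 := choose_add_one_div (n + 2) k
    have h2 := choose_add_one_div (n + 1) k
    have h3 := choose_add_one_div n k
    push_cast at h1 h2
    have e : (k : ℝ) + (n + 2) + 1 = k + n + 3 := by ring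
    have e' : (n : ℝ) + 2 + 1 = n + 3 := by ring
    have d : (k : ℝ) + (n + 1) + 1 = k + n + 2 := by ring
    have d' : (n : ℝ) + 1 + 1 = n + 2 := by ring
    rw [e, e'] at h1
    rw [d, d'] at h2
    rw [nbPMF_add, mul_comm ((Nat.choose _ _ : ℕ) : ℝ), ← mul_assoc, mul_div_assoc, ← div_div,
      ← div_div, h1, div_right_comm _ ((n : ℝ) + 3), h2, div_right_comm _ ((n : ℝ) + 3),
      div_right_comm _ ((n : ℝ) + 2), h3]
    ring
  · field_simp
    ring

theorem nbPMF_add_pos (n k : ℕ) {p : ℝ} (hp0 : 0 < p) (hp1 : p < 1) :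
    0 < nbPMF (n + 4) p (k + (n + 3)) := by
  have : 0 < 1 - p := by linarith
  have : 0 < (k + (n + 3)).choose (n + 3) := Nat.choose_pos (Nat.le_add_left _ _)
  rw [nbPMF_add]
  positivity

theorem Erel_add_four (n : ℕ) (p : ℝ) :
    Erel (n + 4) p = ((n : ℝ) + 3) ^ 2 / p ^ 2 *
      ∑' k : ℕ, nbPMF (n + 4) p (k + (n + 3)) / ((k : ℝ) + n + 3) ^ 2 := by
  have hc : ((n + 4 : ℕ) : ℝ) - 1 = n + 3 := by push_cast; ring
  rw [Erel, hc, ← (add_left_injective (n + 3)).tsum_eq]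
  · congr 2
    funext k
    rw [if_pos (by omega)]
    push_cast
    ring
  · intro x hx
    by_cases h : n + 3 ≤ x
    · exact ⟨x - (n + 3), Nat.sub_add_cancel h⟩
    · exact absurd (if_neg (by omega)) hx

/-- Follows from `1 / x ≥ 2 * c - c ^ 2 * x`, the tangent-line bound at `1 / c`. -/
theorem inv_sq_le_of_one_lt {x : ℝ} (hx : 1 < x) (c : ℝ) :
    1 / x ^ 2 ≤ (1 - c) ^ 2 * (1 / (x * (x - 1))) + c ^ 2 * (1 / x) := by
  have hx0 : 0 < x := by linarith
  have hx1 : 0 < x - 1 := by linarith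
  have h : (1 - c) ^ 2 * (1 / (x * (x - 1))) + c ^ 2 * (1 / x) - 1 / x ^ 2
      = (1 - c * x) ^ 2 / (x ^ 2 * (x - 1)) := by
    field_simp
    ring
  have : 0 ≤ (1 - c * x) ^ 2 / (x ^ 2 * (x - 1)) := by positivity
  linarith

theorem lt_inv_sq_of_two_lt {x : ℝ} (hx : 2 < x) :
    1 / (x * (x - 1)) - 1 / (x * (x - 1) * (x - 2)) < 1 / x ^ 2 := by
  have hx0 : 0 < x := by linarith
  have hx1 : 0 < x - 1 := by linarith
  have hx2 : 0 < x - 2 := by linarith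
  have h : 1 / x ^ 2 - (1 / (x * (x - 1)) - 1 / (x * (x - 1) * (x - 2)))
      = 2 / (x ^ 2 * (x - 1) * (x - 2)) := by
    field_simp
    ring
  have : 0 < 2 / (x ^ 2 * (x - 1) * (x - 2)) := by positivity
  linarith

/-- **Proposition 2, case `𝔰 ≥ 4`**: for every integer `𝔰 ≥ 4` and every
`0 < p < 1`, the two-sided bound
`1 + (1 − (1 + 2/(𝔰−3))·p)/(𝔰−2) < E_rel(𝔰, p) < 1 + (1 − p)/(𝔰−2)` holds. -/
theorem Erel_ge_four (𝔰 : ℕ) (h𝔰 : 4 ≤ 𝔰) (p : ℝ) (hp0 : 0 < p) (hp1 : p < 1) :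
    1 + (1 - (1 + 2 / ((𝔰 : ℝ) - 3)) * p) / ((𝔰 : ℝ) - 2) < Erel 𝔰 p ∧
      Erel 𝔰 p < 1 + (1 - p) / ((𝔰 : ℝ) - 2) := by
  obtain ⟨n, rfl⟩ : ∃ n, 𝔰 = n + 4 := ⟨𝔰 - 4, by omega⟩
  have h1 := hasSum_nbPMF_div n hp0 hp1
  have h2 := hasSum_nbPMF_div_two n hp0 hp1
  have h3 := hasSum_nbPMF_div_three n hp0 hp1
  set c : ℝ := p / (n + 3) with hc
  have hupper (k : ℕ) : nbPMF (n + 4) p (k + (n + 3)) / ((k : ℝ) + n + 3) ^ 2 ≤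
      (1 - c) ^ 2 * (nbPMF (n + 4) p (k + (n + 3)) / (((k : ℝ) + n + 3) * (k + n + 2))) +
        c ^ 2 * (nbPMF (n + 4) p (k + (n + 3)) / ((k : ℝ) + n + 3)) := by
    have hk : (0 : ℝ) ≤ k := k.cast_nonneg
    have hn : (0 : ℝ) ≤ n := n.cast_nonneg
    have h := mul_le_mul_of_nonneg_left
      (inv_sq_le_of_one_lt (x := (k : ℝ) + n + 3) (by linarith) c) (nbPMF_add_pos n k hp0 hp1).le
    rw [show (k : ℝ) + n + 3 - 1 = k + n + 2 by ring] at h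
    refine le_of_eq_of_le ?_ (h.trans_eq ?_) <;> ring
  have hlower (k : ℕ) :
      nbPMF (n + 4) p (k + (n + 3)) / (((k : ℝ) + n + 3) * (k + n + 2)) -
        nbPMF (n + 4) p (k + (n + 3)) / (((k : ℝ) + n + 3) * (k + n + 2) * (k + n + 1)) <
      nbPMF (n + 4) p (k + (n + 3)) / ((k : ℝ) + n + 3) ^ 2 := by
    have hk : (0 : ℝ) ≤ k := k.cast_nonneg
    have hn : (0 : ℝ) ≤ n := n.cast_nonneg
    have h := mul_lt_mul_of_pos_left
      (lt_inv_sq_of_two_lt (x := (k : ℝ) + n + 3) (by linarith)) (nbPMF_add_pos n k hp0 hp1)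
    rw [show (k : ℝ) + n + 3 - 1 = k + n + 2 by ring,
      show (k : ℝ) + n + 3 - 2 = k + n + 1 by ring] at h
    refine lt_of_eq_of_lt ?_ (h.trans_eq ?_) <;> ring
  have hU := (h2.mul_left ((1 - c) ^ 2)).add (h1.mul_left (c ^ 2))
  have hS : Summable fun k : ℕ =>
      nbPMF (n + 4) p (k + (n + 3)) / ((k : ℝ) + n + 3) ^ 2 :=
    hU.summable.of_nonneg_of_le
      (fun k => div_nonneg (nbPMF_add_pos n k hp0 hp1).le (sq_nonneg _)) hupper
  have hle := hasSum_le hupper hS.hasSum hU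
  have hlt := hasSum_lt (fun k => (hlower k).le) (hlower 0) (h2.sub h3) hS.hasSum
  have hpos : 0 < ((n : ℝ) + 3) ^ 2 / p ^ 2 := by positivity
  rw [Erel_add_four]
  push_cast
  rw [show (n : ℝ) + 4 - 3 = n + 1 by ring, show (n : ℝ) + 4 - 2 = n + 2 by ring]
  constructor
  · refine lt_of_eq_of_lt ?_ (mul_lt_mul_of_pos_left hlt hpos)
    field_simp
    ring
  · refine lt_of_le_of_lt (mul_le_mul_of_nonneg_left hle hpos.le) ?_
    have h : 1 + (1 - p) / ((n : ℝ) + 2) - (n + 3) ^ 2 / p ^ 2 *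
        ((1 - c) ^ 2 * (p ^ 2 / ((n + 3) * (n + 2))) + c ^ 2 * c)
        = p * (1 - p) / ((n + 2) * (n + 3)) := by
      rw [hc]
      field_simp
      ring
    have : 0 < p * (1 - p) / (((n : ℝ) + 2) * (n + 3)) :=
      div_pos (mul_pos hp0 (by linarith)) (by positivity)
    linarith
end

section
/- For every integer 𝔰 ≥ 3 and every real p with 0 < p < 1, Σ_{x=𝔰−1}^∞ f_{𝔰,p}(x)/(x(x−1)) = p²/((𝔰−1)(𝔰−2)). That is, the second inverse factorial moment E[1/(X(X−1))] of the shifted negative binomial equals p²/((𝔰−1)(𝔰−2)). -/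
/-- **Second inverse factorial moment of the shifted negative binomial**:
for every integer `𝔰 ≥ 3` and `0 < p < 1`,
`∑_{x ≥ 𝔰−1} f_{𝔰,p}(x)/(x(x−1)) = p²/((𝔰−1)(𝔰−2))`. -/
theorem nbPMF_second_inverse_factorial_moment (𝔰 : ℕ) (h𝔰 : 3 ≤ 𝔰) (p : ℝ)
    (hp0 : 0 < p) (hp1 : p < 1) :
    (∑' x : ℕ, if 𝔰 - 1 ≤ x then nbPMF 𝔰 p x / ((x : ℝ) * ((x : ℝ) - 1)) else 0)
      = p ^ 2 / (((𝔰 : ℝ) - 1) * ((𝔰 : ℝ) - 2)) := by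
  obtain ⟨t, rfl⟩ : ∃ t, 𝔰 = t + 3 := ⟨𝔰 - 3, by omega⟩
  have hinj : Function.Injective (fun n : ℕ => n + (t + 2)) := add_left_injective _
  rw [← hinj.tsum_eq]
  · have hterm : ∀ n : ℕ,
        (if t + 3 - 1 ≤ n + (t + 2) then
          nbPMF (t + 3) p (n + (t + 2)) /
            (((n + (t + 2) : ℕ) : ℝ) * (((n + (t + 2) : ℕ) : ℝ) - 1)) else 0) =
        p ^ (t + 3) / (((t : ℝ) + 2) * ((t : ℝ) + 1)) *
          (((n + t).choose t : ℝ) * (1 - p) ^ n) := by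
      intro n
      have hn : n + (t + 2) + 1 - (t + 3) = n := by omega
      have hx : ((n + (t + 2) : ℕ) : ℝ) - 1 = n + t + 1 := by push_cast; ring
      rw [if_pos (by omega), nbPMF, hn, hx, ← Nat.choose_symm_add, Nat.cast_add_choose,
        show t + 3 - 1 = t + 2 by omega, ← Nat.add_assoc]
      simp only [Nat.factorial_succ]
      push_cast
      field_simp
      ring
    have hq : ‖1 - p‖ < 1 := by
      rw [Real.norm_eq_abs, abs_lt]
      constructor <;> linarith
    rw [tsum_congr hterm, tsum_mul_left, tsum_choose_mul_geometric_of_norm_lt_one t hq]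
    have h₂ : ((t + 3 : ℕ) : ℝ) - 1 = t + 2 := by push_cast; ring
    have h₁ : ((t + 3 : ℕ) : ℝ) - 2 = t + 1 := by push_cast; ring
    rw [h₂, h₁, sub_sub_cancel]
    field_simp
    ring
  · intro x hx
    have hle : t + 3 - 1 ≤ x := by
      by_contra h
      exact hx (if_neg h)
    exact ⟨x - (t + 2), Nat.sub_add_cancel hle⟩
end

section
/- E[∏_{t=1}^T P̂_t²] ≤ c^T · E[∏_{t=1}^T Q_t²]. That is, under a per-step conditional second-moment bound and the conditional independence property of the alive particle filter, the second moment of the product of the per-interval estimators is at most c^T times the second moment of the product of the conditional success probabilities; with c = 1 + 1/(𝔰−2) this yields the relative-variance bound V_rel ≤ exp(T/(𝔰−2))·E[∏_{t=1}^T Q_t²]/E[∏_{t=1}^T Q_t]² − 1 of Theorem 2 for the alive particle filter on partial, exact observations. -/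
open MeasureTheory

lemma integrable_of_ae_mem_Icc {Ω : Type*} [MeasurableSpace Ω] {μ : Measure Ω}
    [IsFiniteMeasure μ] {f : Ω → ℝ} (hf : Measurable f)
    (h01 : ∀ᵐ ω ∂μ, f ω ∈ Set.Icc (0 : ℝ) 1) : Integrable f μ :=
  Integrable.of_mem_Icc 0 1 hf.aemeasurable h01

/-- If `X` and `R` are conditionally uncorrelated given `m` and `E[X | m] ≤ c Y`, then `X` can be
replaced by `c Y` in the expectation of `W X R`, for every bounded `m`-measurable `W ≥ 0`. -/
lemma integral_mul_mul_le_of_condExp_le {Ω : Type*} {m m0 : MeasurableSpace Ω} {μ : Measure Ω}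
    [IsFiniteMeasure μ] (hm : m ≤ m0) {c : ℝ} {W X Y R : Ω → ℝ}
    (hW : Measurable[m] W) (hX : Measurable X) (hY : Measurable[m] Y) (hR : Measurable R)
    (hW01 : ∀ᵐ ω ∂μ, W ω ∈ Set.Icc (0 : ℝ) 1) (hX01 : ∀ᵐ ω ∂μ, X ω ∈ Set.Icc (0 : ℝ) 1)
    (hY01 : ∀ᵐ ω ∂μ, Y ω ∈ Set.Icc (0 : ℝ) 1) (hR01 : ∀ᵐ ω ∂μ, R ω ∈ Set.Icc (0 : ℝ) 1)
    (hXY : μ[X|m] ≤ᵐ[μ] fun ω => c * Y ω)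
    (hXR : μ[X * R|m] =ᵐ[μ] fun ω => μ[X|m] ω * μ[R|m] ω) :
    ∫ ω, W ω * (X ω * R ω) ∂μ ≤ c * ∫ ω, W ω * (Y ω * R ω) ∂μ := by
  have hWm := hW.mono hm le_rfl
  have hYm := hY.mono hm le_rfl
  have hXRi : Integrable (X * R) μ := integrable_of_ae_mem_Icc (hX.mul hR) <| by
    filter_upwards [hX01, hR01] with ω h1 h2 using unitInterval.mul_mem h1 h2
  have hWXRi : Integrable (W * (X * R)) μ :=
    integrable_of_ae_mem_Icc (hWm.mul (hX.mul hR)) <| by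
      filter_upwards [hW01, hX01, hR01] with ω h0 h1 h2
        using unitInterval.mul_mem h0 (unitInterval.mul_mem h1 h2)
  have hWYRi : Integrable (W * Y * R) μ :=
    integrable_of_ae_mem_Icc ((hWm.mul hYm).mul hR) <| by
      filter_upwards [hW01, hY01, hR01] with ω h0 h1 h2
        using unitInterval.mul_mem (unitInterval.mul_mem h0 h1) h2
  have hRi : Integrable R μ := integrable_of_ae_mem_Icc hR hR01
  have hRnonneg : 0 ≤ᵐ[μ] μ[R|m] := condExp_nonneg (hR01.mono fun _ h => h.1)
  have hle : μ[W * (X * R)|m] ≤ᵐ[μ] fun ω => c * μ[W * Y * R|m] ω := by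
    filter_upwards [condExp_mul_of_stronglyMeasurable_left hW.stronglyMeasurable hWXRi hXRi,
      condExp_mul_of_stronglyMeasurable_left (hW.mul hY).stronglyMeasurable hWYRi hRi,
      hXY, hXR, hRnonneg, hW01] with ω h1 h2 h3 h4 h5 h6
    simp only [Pi.mul_apply, Pi.zero_apply] at h1 h2 h5
    rw [h1, h2, h4]
    calc W ω * (μ[X|m] ω * μ[R|m] ω) ≤ W ω * (c * Y ω * μ[R|m] ω) :=
          mul_le_mul_of_nonneg_left (mul_le_mul_of_nonneg_right h3 h5) h6.1
      _ = c * (W ω * Y ω * μ[R|m] ω) := by ring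
  calc ∫ ω, W ω * (X ω * R ω) ∂μ = ∫ ω, μ[W * (X * R)|m] ω ∂μ := (integral_condExp hm).symm
    _ ≤ ∫ ω, c * μ[W * Y * R|m] ω ∂μ :=
      integral_mono_ae integrable_condExp (integrable_condExp.const_mul c) hle
    _ = c * ∫ ω, W ω * (Y ω * R ω) ∂μ := by
      rw [integral_const_mul, integral_condExp hm]
      simp only [Pi.mul_apply, mul_assoc]

lemma ae_prod_sq_mem_Icc {Ω ι : Type*} [MeasurableSpace Ω] {μ : Measure Ω} {f : ι → Ω → ℝ}
    {s : Finset ι} (h : ∀ i ∈ s, ∀ᵐ ω ∂μ, f i ω ∈ Set.Icc (0 : ℝ) 1) :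
    ∀ᵐ ω ∂μ, ∏ i ∈ s, f i ω ^ 2 ∈ Set.Icc (0 : ℝ) 1 := by
  filter_upwards [(Finset.eventually_all s).2 h] with ω hω
  exact ⟨Finset.prod_nonneg fun i _ => sq_nonneg _,
    Finset.prod_le_one (fun i _ => sq_nonneg _) fun i hi => pow_le_one₀ (hω i hi).1 (hω i hi).2⟩

/-- **Theorem 2 (abstract form): second-moment bound for the alive particle filter
on partial, exact observations.**  On a probability space with a filtration
`𝓕 0 ⊆ 𝓕 1 ⊆ … ⊆ 𝓕 T` of sub-σ-algebras and a constant `c ≥ 0`, let `P̂ t` be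
`𝓕 t`-measurable and `Q t` be `𝓕 (t−1)`-measurable for `t = 1, …, T`, each with
values in `[0, 1]` a.s.  If for each `t`:
(i) `E[P̂ t² | 𝓕 (t−1)] ≤ c · Q t²` a.s., and
(ii) `E[P̂ t² · ∏_{s=t+1}^T Q s² | 𝓕 (t−1)]
      = E[P̂ t² | 𝓕 (t−1)] · E[∏_{s=t+1}^T Q s² | 𝓕 (t−1)]` a.s.,
then `E[∏_{t=1}^T P̂ t²] ≤ c^T · E[∏_{t=1}^T Q t²]`.  With `c = 1 + 1/(𝔰−2)` this
yields the relative-variance bound of Theorem 2. -/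
theorem alive_filter_product_second_moment_bound
    {Ω : Type*} [m0 : MeasurableSpace Ω] (μ : Measure Ω) [IsProbabilityMeasure μ]
    (T : ℕ) (𝓕 : ℕ → MeasurableSpace Ω)
    (h𝓕mono : Monotone 𝓕) (h𝓕le : ∀ t, 𝓕 t ≤ m0)
    (c : ℝ) (hc : 0 ≤ c)
    (Phat Q : ℕ → Ω → ℝ)
    (hPmeas : ∀ t ∈ Finset.Icc 1 T, Measurable[𝓕 t] (Phat t))
    (hQmeas : ∀ t ∈ Finset.Icc 1 T, Measurable[𝓕 (t - 1)] (Q t))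
    (hPbdd : ∀ t ∈ Finset.Icc 1 T, ∀ᵐ ω ∂μ, Phat t ω ∈ Set.Icc (0 : ℝ) 1)
    (hQbdd : ∀ t ∈ Finset.Icc 1 T, ∀ᵐ ω ∂μ, Q t ω ∈ Set.Icc (0 : ℝ) 1)
    (h_i : ∀ t ∈ Finset.Icc 1 T,
      μ[fun ω => (Phat t ω) ^ 2|𝓕 (t - 1)] ≤ᵐ[μ] fun ω => c * (Q t ω) ^ 2)
    (h_ii : ∀ t ∈ Finset.Icc 1 T,
      μ[(fun ω => (Phat t ω) ^ 2 * ∏ s ∈ Finset.Icc (t + 1) T, (Q s ω) ^ 2)|𝓕 (t - 1)]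
        =ᵐ[μ] fun ω => ((μ[fun ω' => (Phat t ω') ^ 2|𝓕 (t - 1)]) ω) *
          ((μ[(fun ω' => ∏ s ∈ Finset.Icc (t + 1) T, (Q s ω') ^ 2)|𝓕 (t - 1)]) ω)) :
    ∫ ω, ∏ t ∈ Finset.Icc 1 T, (Phat t ω) ^ 2 ∂μ
      ≤ c ^ T * ∫ ω, ∏ t ∈ Finset.Icc 1 T, (Q t ω) ^ 2 ∂μ := by
  have hmixed : ∀ k ≤ T,
      ∫ ω, (∏ t ∈ Finset.Icc 1 k, Phat t ω ^ 2) * ∏ t ∈ Finset.Icc (k + 1) T, Q t ω ^ 2 ∂μ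
        ≤ c ^ k * ∫ ω, ∏ t ∈ Finset.Icc 1 T, Q t ω ^ 2 ∂μ := by
    intro k
    induction k with
    | zero => intro _; simp
    | succ k ih =>
      intro hk
      have hmem : k + 1 ∈ Finset.Icc 1 T := Finset.mem_Icc.2 ⟨by lia, hk⟩
      have hpast : ∀ t ∈ Finset.Icc 1 k, t ∈ Finset.Icc 1 T := fun t ht => by
        rw [Finset.mem_Icc] at ht ⊢; lia
      have hfuture : ∀ t ∈ Finset.Icc (k + 1 + 1) T, t ∈ Finset.Icc 1 T := fun t ht => by
        rw [Finset.mem_Icc] at ht ⊢; lia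
      have hsq : ∀ {f : Ω → ℝ}, (∀ᵐ ω ∂μ, f ω ∈ Set.Icc (0 : ℝ) 1) →
          ∀ᵐ ω ∂μ, f ω ^ 2 ∈ Set.Icc (0 : ℝ) 1 := fun hf =>
        hf.mono fun ω h => ⟨sq_nonneg _, pow_le_one₀ h.1 h.2⟩
      have hstep := integral_mul_mul_le_of_condExp_le (h𝓕le k) (c := c)
        (W := fun ω => ∏ t ∈ Finset.Icc 1 k, Phat t ω ^ 2)
        (X := fun ω => Phat (k + 1) ω ^ 2) (Y := fun ω => Q (k + 1) ω ^ 2)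
        (R := fun ω => ∏ t ∈ Finset.Icc (k + 1 + 1) T, Q t ω ^ 2)
        (Finset.measurable_fun_prod _ fun t ht =>
          ((hPmeas t (hpast t ht)).mono (h𝓕mono (Finset.mem_Icc.1 ht).2) le_rfl).pow_const 2)
        (((hPmeas _ hmem).mono (h𝓕le _) le_rfl).pow_const 2)
        ((hQmeas _ hmem).pow_const 2)
        (Finset.measurable_fun_prod _ fun t ht =>
          ((hQmeas t (hfuture t ht)).mono (h𝓕le _) le_rfl).pow_const 2)
        (ae_prod_sq_mem_Icc fun t ht => hPbdd t (hpast t ht))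
        (hsq (hPbdd _ hmem)) (hsq (hQbdd _ hmem))
        (ae_prod_sq_mem_Icc fun t ht => hQbdd t (hfuture t ht))
        (h_i _ hmem) (h_ii _ hmem)
      calc _ = _ := by simp only [Finset.prod_Icc_succ_top (Nat.le_add_left 1 k), mul_assoc]
        _ ≤ _ := hstep
        _ = c * ∫ ω, (∏ t ∈ Finset.Icc 1 k, Phat t ω ^ 2) *
              ∏ t ∈ Finset.Icc (k + 1) T, Q t ω ^ 2 ∂μ := by
          simp only [← Finset.insert_Icc_add_one_left_eq_Icc hk]
          simp
        _ ≤ c * (c ^ k * ∫ ω, ∏ t ∈ Finset.Icc 1 T, Q t ω ^ 2 ∂μ) :=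
          mul_le_mul_of_nonneg_left (ih (by lia)) hc
        _ = _ := by ring
  simpa using hmixed T le_rfl
end
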